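/- arXiv:math/0507420 — 3 statements merged into one kernel-verified Lean document; each statement's English description precedes it below -/
import Mathlib

section
/- For the stepdown procedure with constants α_i = kα/s for i ≤ k and α_i = kα/(s+k−i) for i > k, the number of false rejections F(ω) = #{i ≤ R(ω) : σ_ω(i) ∈ I} satisfies P{F ≥ k} ≤ α; that is, this stepdown procedure controls the k-FWER at level α. -/
open MeasureTheory Set

/-- Markov's inequality for a count of events: `k` times the probability that at least `k` of the
events `A i`, `i ∈ I`, occur is at most the sum of their probabilities. -/
theorem mul_measure_le_card_filter_le_sum {Ω ι : Type*} [MeasurableSpace Ω] (P : Measure Ω)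
    (I : Finset ι) (A : ι → Set Ω) [∀ ω, DecidablePred fun i => ω ∈ A i]
    (hA : ∀ i ∈ I, MeasurableSet (A i)) (k : ℕ) :
    (k : ENNReal) * P {ω | k ≤ (I.filter fun i => ω ∈ A i).card} ≤ ∑ i ∈ I, P (A i) := by
  have hcount (ω : Ω) : ((I.filter fun i => ω ∈ A i).card : ENNReal)
      = ∑ i ∈ I, (A i).indicator 1 ω := by
    rw [Finset.card_filter]
    push_cast
    exact Finset.sum_congr rfl fun i _ => by simp [Set.indicator_apply]
  have hmeas (i : ι) (hi : i ∈ I) : Measurable ((A i).indicator (1 : Ω → ENNReal)) :=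
    measurable_one.indicator (hA i hi)
  calc (k : ENNReal) * P {ω | k ≤ (I.filter fun i => ω ∈ A i).card}
      = (k : ENNReal) * P {ω | (k : ENNReal) ≤ ∑ i ∈ I, (A i).indicator 1 ω} := by
        simp only [← hcount, Nat.cast_le]
    _ ≤ ∫⁻ ω, ∑ i ∈ I, (A i).indicator 1 ω ∂P :=
        mul_meas_ge_le_lintegral (Finset.measurable_fun_sum I hmeas) _
    _ = ∑ i ∈ I, P (A i) := by
        rw [lintegral_finsetSum I hmeas]
        exact Finset.sum_congr rfl fun i hi => lintegral_indicator_one (hA i hi)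

/-- If a predicate on `Fin s` is inherited by smaller indices, it holds at every index smaller
than the number of indices satisfying it. -/
theorem Fin.of_lt_card_filter {s : ℕ} (Q : Fin s → Prop) [DecidablePred Q]
    (hQ : ∀ i j, i ≤ j → Q j → Q i) (j : Fin s) (hj : j.val < (Finset.univ.filter Q).card) :
    Q j := by
  by_contra h
  have hsub : Finset.univ.filter Q ⊆ Finset.Iio j := by
    intro r hr
    rw [Finset.mem_Iio]
    by_contra hlt
    exact h (hQ j r (not_lt.mp hlt) (Finset.mem_filter.mp hr).2)
  have := Finset.card_le_card hsub
  rw [Fin.card_Iio] at this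
  omega

/-- Suppose `q i ≤ d i` at the first `R` positions, at least `k` of which lie in `T`, and
`d i ≤ u` whenever `T.card + i < s + k`. Then `q i ≤ u` for at least `k` positions `i ∈ T`. -/
theorem Fin.le_card_filter_le_of_stepdown {s : ℕ} (T : Finset (Fin s)) (q d : Fin s → ℝ)
    (R k : ℕ) (u : ℝ) (hq : ∀ i : Fin s, i.val < R → q i ≤ d i)
    (hk : k ≤ (T.filter fun i => i.val < R).card)
    (hd : ∀ i : Fin s, T.card + i.val < s + k → d i ≤ u) :
    k ≤ (T.filter fun i => q i ≤ u).card := by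
  by_contra! hlt
  obtain ⟨j, hj, hmin⟩ : ∃ j ∈ T.filter fun i => i.val < R ∧ ¬ q i ≤ u,
      ∀ i ∈ T.filter fun i => i.val < R ∧ ¬ q i ≤ u, j ≤ i := by
    refine Finset.exists_min_image _ id ?_
    by_contra hne
    have hsub : (T.filter fun i => i.val < R) ⊆ T.filter fun i => q i ≤ u := by
      intro i hi
      rw [Finset.mem_filter] at hi ⊢
      by_contra hi'
      exact hne ⟨i, Finset.mem_filter.mpr ⟨hi.1, hi.2, fun h => hi' ⟨hi.1, h⟩⟩⟩
    have := Finset.card_le_card hsub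
    omega
  obtain ⟨-, hjR, hju⟩ := Finset.mem_filter.mp hj
  have hsub : T ⊆ (T.filter fun i => q i ≤ u) ∪ Finset.Ici j := by
    intro i hi
    by_contra hi'
    rw [Finset.mem_union, Finset.mem_filter, Finset.mem_Ici] at hi'
    push Not at hi'
    have hij : i.val < j.val := hi'.2
    exact absurd (hmin i (Finset.mem_filter.mpr ⟨hi, by omega, not_le.mpr (hi'.1 hi)⟩))
      (not_le.mpr hi'.2)
  have hcard := (Finset.card_le_card hsub).trans (Finset.card_union_le _ _)
  rw [Fin.card_Ici] at hcard
  have := j.isLt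
  exact hju ((hq j hjR).trans (hd j (by omega)))

/-- Theorem 2.2 of Lehmann–Romano: the stepdown procedure with constants
`α_i = kα/s` for `i ≤ k` and `α_i = kα/(s+k−i)` for `i > k` controls the
`k`-FWER at level `α`. Here `σ ω` is a measurable permutation sorting the
p-values, `R ω` the number of rejections and `F ω` the number of false
rejections (those among the true null hypotheses `I`). -/
theorem stepdown_controls_kFWER
    {Ω : Type*} [MeasurableSpace Ω] (P : Measure Ω) [IsProbabilityMeasure P]
    (s : ℕ) (hs : 1 ≤ s) (p : Fin s → Ω → ℝ)
    (hmeas : ∀ i, Measurable (p i)) (hrange : ∀ i ω, p i ω ∈ Set.Icc (0:ℝ) 1)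
    (I : Finset (Fin s))
    (hI : ∀ i ∈ I, ∀ u ∈ Set.Ioo (0:ℝ) 1, P {ω | p i ω ≤ u} ≤ ENNReal.ofReal u)
    (k : ℕ) (hk1 : 1 ≤ k) (hks : k ≤ s) (α : ℝ) (hα : α ∈ Set.Ioo (0:ℝ) 1)
    (c : ℕ → ℝ)
    (hc : ∀ i, 1 ≤ i → i ≤ s →
      c i = if i ≤ k then (k : ℝ) * α / (s : ℝ)
            else (k : ℝ) * α / ((s : ℝ) + (k : ℝ) - (i : ℝ)))
    (σ : Ω → Equiv.Perm (Fin s))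
    (hσmono : ∀ ω, Monotone fun i => p (σ ω i) ω)
    (hσmeas : ∀ i : Fin s, Measurable fun ω => σ ω i)
    (R : Ω → ℕ)
    (hR : ∀ ω, R ω = (Finset.univ.filter
      (fun r : Fin s => ∀ i : Fin s, i ≤ r → p (σ ω i) ω ≤ c (i.val + 1))).card)
    (F : Ω → ℕ)
    (hF : ∀ ω, F ω = (Finset.univ.filter
      (fun i : Fin s => i.val < R ω ∧ σ ω i ∈ I)).card) :
    P {ω | k ≤ F ω} ≤ ENNReal.ofReal α := by
  rcases lt_or_ge I.card k with hIk | hIk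
  · have hempty : {ω | k ≤ F ω} = ∅ := by
      refine Set.eq_empty_of_forall_notMem fun ω (hω : k ≤ F ω) => ?_
      have hle : F ω ≤ I.card := by
        rw [hF]
        exact Finset.card_le_card_of_injOn (σ ω) (fun i hi => (Finset.mem_filter.mp hi).2.2)
          (σ ω).injective.injOn
      omega
    simp [hempty]
  have hkpos : (0 : ℝ) < k := by exact_mod_cast hk1
  have hkm : (k : ℝ) ≤ I.card := by exact_mod_cast hIk
  have hmpos : (0 : ℝ) < I.card := hkpos.trans_le hkm
  have hnum : 0 < (k : ℝ) * α := mul_pos hkpos hα.1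
  set u : ℝ := k * α / I.card with hu
  have hu1 : u < 1 := by
    rw [hu, div_lt_one hmpos]
    nlinarith [hα.2]
  have hcu (i : Fin s) (hi : I.card + i.val < s + k) : c (i.val + 1) ≤ u := by
    have hIs : I.card ≤ s := by simpa using I.card_le_univ
    rw [hc _ (by omega) (by omega)]
    split_ifs
    · exact div_le_div_of_nonneg_left hnum.le hmpos (by exact_mod_cast hIs)
    · refine div_le_div_of_nonneg_left hnum.le hmpos ?_
      have : (I.card : ℝ) + (i.val + 1 : ℕ) ≤ s + k := by exact_mod_cast hi
      linarith
  have hsub : {ω | k ≤ F ω} ⊆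
      {ω | k ≤ (I.filter fun i => ω ∈ {ω | p i ω ≤ u}).card} := by
    intro ω (hω : k ≤ F ω)
    have hT : (Finset.univ.filter fun i => σ ω i ∈ I).card = I.card :=
      Finset.card_bij (fun i _ => σ ω i) (fun i hi => (Finset.mem_filter.mp hi).2)
        (fun _ _ _ _ h => (σ ω).injective h)
        (fun b hb => ⟨(σ ω).symm b, by simpa using hb, by simp⟩)
    have hcount := Fin.le_card_filter_le_of_stepdown (Finset.univ.filter fun i => σ ω i ∈ I)
      (fun i => p (σ ω i) ω) (fun i => c (i.val + 1)) (R ω) k u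
      (fun i hi => Fin.of_lt_card_filter
        (fun r : Fin s => ∀ i : Fin s, i ≤ r → p (σ ω i) ω ≤ c (i.val + 1))
        (fun _ _ hij h l hl => h l (hl.trans hij)) i (hR ω ▸ hi) i le_rfl)
      (by
        rw [hF] at hω
        simpa only [Finset.filter_filter, and_comm] using hω)
      (fun i hi => hcu i (hT ▸ hi))
    refine hcount.trans (Finset.card_le_card_of_injOn (σ ω) (fun i hi => ?_)
      (σ ω).injective.injOn)
    simpa using hi
  have hmarkov := mul_measure_le_card_filter_le_sum P I (fun i => {ω | p i ω ≤ u})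
    (fun i _ => measurableSet_le (hmeas i) measurable_const) k
  have hsum : ∑ i ∈ I, P {ω | p i ω ≤ u} ≤ (k : ENNReal) * ENNReal.ofReal α := by
    calc ∑ i ∈ I, P {ω | p i ω ≤ u}
        ≤ ∑ _i ∈ I, ENNReal.ofReal u :=
          Finset.sum_le_sum fun i hi => hI i hi u ⟨div_pos hnum hmpos, hu1⟩
      _ = (k : ENNReal) * ENNReal.ofReal α := by
          rw [Finset.sum_const, nsmul_eq_mul, ← ENNReal.ofReal_natCast, ← ENNReal.ofReal_natCast,
            ← ENNReal.ofReal_mul hmpos.le, ← ENNReal.ofReal_mul hkpos.le, hu,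
            mul_div_cancel₀ _ hmpos.ne']
  have hk0 : (k : ENNReal) ≠ 0 := by exact_mod_cast (by omega : k ≠ 0)
  exact (measure_mono hsub).trans
    ((ENNReal.mul_le_mul_iff_right hk0 (ENNReal.natCast_ne_top k)).mp (hmarkov.trans hsum))
end

section
/- Let p̂_1, …, p̂_t be random variables in [0,1] with ordered values p̂_(1) ≤ ⋯ ≤ p̂_(t), let 0 = β_0 ≤ β_1 ≤ ⋯ ≤ β_m ≤ 1 with m ≤ t, let J be the smallest index j ∈ {1,…,m} with p̂_(j) ≤ β_j (and J = t + 1 if there is no such j), and let θ_k = P{J = k}. Then for every j = 1, …, m, Σ_{k=1}^j k·θ_k ≤ E[#{i : p̂_i ≤ β_j}]; in particular, if P{p̂_i ≤ u} ≤ u for all i and u ∈ (0,1), then Σ_{k=1}^j k·θ_k ≤ t·β_j. -/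
open MeasureTheory Set

/-- The `i`-th smallest element (0-indexed) of a multiset of reals. -/
noncomputable def orderStat (l : Multiset ℝ) (i : ℕ) : ℝ :=
  (l.sort (· ≤ ·)).getD i 0

theorem List.getElem_le_iff_lt_countP_of_pairwise {α : Type*} [LinearOrder α] {l : List α}
    (hl : l.Pairwise (· ≤ ·)) (x : α) {i : ℕ} (hi : i < l.length) :
    l[i] ≤ x ↔ i < l.countP (· ≤ x) := by
  induction l generalizing i with
  | nil => simp at hi
  | cons a l ih =>
    rw [List.pairwise_cons] at hl
    by_cases hax : a ≤ x
    · cases i with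
      | zero => simp [hax]
      | succ i => simpa [hax] using ih hl.2 (by simpa using hi)
    · have hcount : (a :: l).countP (· ≤ x) = 0 := by
        rw [List.countP_eq_zero]
        intro b hb hbx
        rcases List.mem_cons.1 hb with rfl | hb
        · exact hax (by simpa using hbx)
        · exact hax ((hl.1 b hb).trans (by simpa using hbx))
      rw [hcount]
      refine iff_of_false (fun h => ?_) (Nat.not_lt_zero i)
      cases i with
      | zero => exact hax h
      | succ i => exact hax ((hl.1 _ (List.getElem_mem _)).trans h)

theorem orderStat_le_iff_lt_countP (s : Multiset ℝ) (x : ℝ) {i : ℕ} (hi : i < s.card) :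
    orderStat s i ≤ x ↔ i < s.countP (· ≤ x) := by
  have hlen : i < (s.sort (· ≤ ·)).length := by rwa [Multiset.length_sort]
  have hcount : s.countP (· ≤ x) = (s.sort (· ≤ ·)).countP (· ≤ x) := by
    conv_lhs => rw [← Multiset.sort_eq s (· ≤ ·)]
    exact Multiset.coe_countP _ _
  rw [orderStat, List.getD_eq_getElem _ _ hlen, hcount]
  exact List.getElem_le_iff_lt_countP_of_pairwise (Multiset.pairwise_sort s (· ≤ ·)) x hlen

theorem orderStat_map_univ_le_iff {ι : Type*} [Fintype ι] (f : ι → ℝ) (x : ℝ) {i : ℕ}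
    (hi : 1 ≤ i) (hi' : i ≤ Fintype.card ι) :
    orderStat (Multiset.map f Finset.univ.val) (i - 1) ≤ x ↔
      i ≤ (Finset.univ.filter (fun k => f k ≤ x)).card := by
  rw [orderStat_le_iff_lt_countP _ _ (by simp; omega), Multiset.countP_map]
  change i - 1 < (Finset.univ.filter (fun k => f k ≤ x)).card ↔ _
  omega

theorem measurable_card_filter_le {Ω ι : Type*} [MeasurableSpace Ω] [Fintype ι]
    {f : ι → Ω → ℝ} (hf : ∀ i, Measurable (f i)) (x : ℝ) :
    Measurable fun ω => (Finset.univ.filter (fun i => f i ω ≤ x)).card := by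
  simp_rw [Finset.card_filter]
  exact Finset.measurable_fun_sum _ fun i _ =>
    Measurable.ite (measurableSet_le (hf i) measurable_const) measurable_const measurable_const

theorem integrable_card_filter_le {Ω ι : Type*} [MeasurableSpace Ω] [Fintype ι]
    (P : Measure Ω) [IsFiniteMeasure P]
    {f : ι → Ω → ℝ} (hf : ∀ i, Measurable (f i)) (x : ℝ) :
    Integrable (fun ω => ((Finset.univ.filter (fun i => f i ω ≤ x)).card : ℝ)) P := by
  refine Integrable.of_bound
    (measurable_from_top.comp (measurable_card_filter_le hf x)).aestronglyMeasurable
    (Fintype.card ι) (Filter.Eventually.of_forall fun ω => ?_)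
  simpa using Finset.card_le_univ (Finset.univ.filter (fun i => f i ω ≤ x))

theorem integral_card_filter_le {Ω ι : Type*} [MeasurableSpace Ω] [Fintype ι]
    (P : Measure Ω) [IsFiniteMeasure P]
    {f : ι → Ω → ℝ} (hf : ∀ i, Measurable (f i)) (x : ℝ) :
    ∫ ω, ((Finset.univ.filter (fun i => f i ω ≤ x)).card : ℝ) ∂P =
      ∑ i, P.real {ω | f i ω ≤ x} := by
  have hset i : MeasurableSet {ω | f i ω ≤ x} := measurableSet_le (hf i) measurable_const
  have hcard ω : ((Finset.univ.filter (fun i => f i ω ≤ x)).card : ℝ) =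
      ∑ i, {ω | f i ω ≤ x}.indicator (fun _ => (1 : ℝ)) ω := by
    simp [Set.indicator_apply]
  simp_rw [hcard]
  rw [integral_finsetSum _ fun i _ => (integrable_const (1 : ℝ)).indicator (hset i)]
  simp [integral_indicator, hset]

theorem sum_mul_measureReal_le_integral {Ω : Type*} [MeasurableSpace Ω] (P : Measure Ω)
    [IsFiniteMeasure P] (s : Finset ℕ) {J : Ω → ℕ}
    (hJ : ∀ k ∈ s, MeasurableSet {ω | J ω = k}) {g : Ω → ℝ} (hg : Integrable g P)
    (hg0 : ∀ ω, 0 ≤ g ω) (hJg : ∀ ω, J ω ∈ s → (J ω : ℝ) ≤ g ω) :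
    ∑ k ∈ s, (k : ℝ) * P.real {ω | J ω = k} ≤ ∫ ω, g ω ∂P := by
  have hint k (hk : k ∈ s) :
      Integrable ({ω | J ω = k}.indicator fun _ => (k : ℝ)) P :=
    (integrable_const _).indicator (hJ k hk)
  calc ∑ k ∈ s, (k : ℝ) * P.real {ω | J ω = k}
      = ∑ k ∈ s, ∫ ω, {ω | J ω = k}.indicator (fun _ => (k : ℝ)) ω ∂P := by
        refine Finset.sum_congr rfl fun k hk => ?_
        rw [integral_indicator_const _ (hJ k hk), smul_eq_mul, mul_comm]
    _ = ∫ ω, ∑ k ∈ s, {ω | J ω = k}.indicator (fun _ => (k : ℝ)) ω ∂P :=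
        (integral_finsetSum _ hint).symm
    _ ≤ ∫ ω, g ω ∂P := by
        refine integral_mono (integrable_finsetSum _ hint) hg fun ω => ?_
        by_cases h : J ω ∈ s
        · simpa [Set.indicator_apply, h] using hJg ω h
        · simpa [Set.indicator_apply, h] using hg0 ω

/-- A super-uniform variable on the open unit interval is super-uniform on the closed one. -/
theorem measureReal_le_of_superuniform {Ω : Type*} [MeasurableSpace Ω] (P : Measure Ω)
    [IsProbabilityMeasure P] {X : Ω → ℝ}
    (hX : ∀ u ∈ Set.Ioo (0 : ℝ) 1, P {ω | X ω ≤ u} ≤ ENNReal.ofReal u)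
    {b : ℝ} (hb0 : 0 ≤ b) :
    P.real {ω | X ω ≤ b} ≤ b := by
  refine le_of_forall_gt_imp_ge_of_dense fun u hbu => ?_
  rcases lt_or_ge u 1 with hu | hu
  · calc P.real {ω | X ω ≤ b} ≤ P.real {ω | X ω ≤ u} :=
          measureReal_mono fun ω (h : X ω ≤ b) => h.trans hbu.le
      _ ≤ u := ENNReal.toReal_le_of_le_ofReal (hb0.trans hbu.le)
          (hX u ⟨hb0.trans_lt hbu, hu⟩)
  · exact measureReal_le_one.trans hu

/-- The key inequality (32) in the proof of Lemma 3.1 of Lehmann–Romano: with `J` the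
smallest index `j ∈ {1,…,m}` with `p̂_(j) ≤ β_j` (and `J = t+1` if none) and
`θ_k = P{J = k}`, one has `Σ_{k=1}^j k θ_k ≤ E[#{i : p̂_i ≤ β_j}]` for every
`j = 1, …, m`; in particular `Σ_{k=1}^j k θ_k ≤ t β_j` when the `p̂_i` are p-values. -/
theorem stopping_index_expectation_bound
    {Ω : Type*} [MeasurableSpace Ω] (P : Measure Ω) [IsProbabilityMeasure P]
    (t : ℕ) (ht : 1 ≤ t) (phat : Fin t → Ω → ℝ)
    (hmeas : ∀ i, Measurable (phat i)) (hrange : ∀ i ω, phat i ω ∈ Set.Icc (0:ℝ) 1)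
    (m : ℕ) (hm1 : 1 ≤ m) (hmt : m ≤ t)
    (β : ℕ → ℝ) (hβ0 : β 0 = 0) (hβmono : ∀ i < m, β i ≤ β (i + 1)) (hβ1 : β m ≤ 1)
    (J : Ω → ℕ)
    (hJleast : ∀ ω, (∃ j, 1 ≤ j ∧ j ≤ m ∧
        orderStat (Multiset.map (fun idx => phat idx ω) Finset.univ.val) (j - 1) ≤ β j) →
      IsLeast {j | 1 ≤ j ∧ j ≤ m ∧
        orderStat (Multiset.map (fun idx => phat idx ω) Finset.univ.val) (j - 1) ≤ β j}
        (J ω))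
    (hJnone : ∀ ω, (¬ ∃ j, 1 ≤ j ∧ j ≤ m ∧
        orderStat (Multiset.map (fun idx => phat idx ω) Finset.univ.val) (j - 1) ≤ β j) →
      J ω = t + 1) :
    (∀ j, 1 ≤ j → j ≤ m →
      ∑ k ∈ Finset.Icc 1 j, (k : ℝ) * (P {ω | J ω = k}).toReal ≤
        ∫ ω, ((Finset.univ.filter (fun i : Fin t => phat i ω ≤ β j)).card : ℝ) ∂P) ∧
    ((∀ i, ∀ u ∈ Set.Ioo (0:ℝ) 1, P {ω | phat i ω ≤ u} ≤ ENNReal.ofReal u) →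
      ∀ j, 1 ≤ j → j ≤ m →
        ∑ k ∈ Finset.Icc 1 j, (k : ℝ) * (P {ω | J ω = k}).toReal ≤ (t : ℝ) * β j) := by
  set N : ℕ → Ω → ℕ := fun j ω => (Finset.univ.filter (fun i : Fin t => phat i ω ≤ β j)).card
  have hcross ω {j : ℕ} (hj1 : 1 ≤ j) (hjm : j ≤ m) :
      orderStat (Multiset.map (fun idx => phat idx ω) Finset.univ.val) (j - 1) ≤ β j ↔
        j ≤ N j ω :=
    orderStat_map_univ_le_iff _ _ hj1 (by simpa using hjm.trans hmt)
  have hβ {i j : ℕ} (hij : i ≤ j) (hjm : j ≤ m) : β i ≤ β j := by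
    induction j, hij using Nat.le_induction with
    | base => exact le_rfl
    | succ j _ ih => exact (ih (by omega)).trans (hβmono j (by omega))
  have hJ ω {k : ℕ} (hk1 : 1 ≤ k) (hkm : k ≤ m) :
      J ω = k ↔ k ≤ N k ω ∧ ∀ l ∈ Finset.Ico 1 k, ¬ l ≤ N l ω := by
    constructor
    · rintro rfl
      have hleast := hJleast ω (by
        by_contra h
        have := hJnone ω h
        omega)
      refine ⟨(hcross ω hk1 hkm).1 hleast.1.2.2, fun l hl hlN => ?_⟩
      rw [Finset.mem_Ico] at hl
      have := hleast.2 ⟨hl.1, by omega, (hcross ω hl.1 (by omega)).2 hlN⟩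
      omega
    · rintro ⟨hkN, hlt⟩
      have hk := (hcross ω hk1 hkm).2 hkN
      have hleast := hJleast ω ⟨k, hk1, hkm, hk⟩
      refine le_antisymm (hleast.2 ⟨hk1, hkm, hk⟩) ?_
      by_contra! h
      exact hlt (J ω) (Finset.mem_Ico.2 ⟨hleast.1.1, h⟩)
        ((hcross ω hleast.1.1 hleast.1.2.1).1 hleast.1.2.2)
  have hNset l : MeasurableSet {ω | l ≤ N l ω} :=
    measurableSet_le measurable_const (measurable_card_filter_le hmeas (β l))
  have hJset {k : ℕ} (hk1 : 1 ≤ k) (hkm : k ≤ m) : MeasurableSet {ω | J ω = k} := by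
    simp_rw [hJ _ hk1 hkm]
    have hinter := (hNset k).inter
      (Finset.measurableSet_biInter (Finset.Ico 1 k) fun l _ => (hNset l).compl)
    convert hinter using 1
    ext ω
    simp
  have hbound : ∀ j, 1 ≤ j → j ≤ m →
      ∑ k ∈ Finset.Icc 1 j, (k : ℝ) * P.real {ω | J ω = k} ≤ ∫ ω, (N j ω : ℝ) ∂P := by
    intro j _ hjm
    refine sum_mul_measureReal_le_integral P _ (fun k hk => ?_)
      (integrable_card_filter_le P hmeas (β j)) (fun ω => Nat.cast_nonneg _) fun ω hω => ?_
    · rw [Finset.mem_Icc] at hk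
      exact hJset hk.1 (hk.2.trans hjm)
    · rw [Finset.mem_Icc] at hω
      refine Nat.cast_le.2 ((((hJ ω hω.1 (hω.2.trans hjm)).1 rfl).1).trans ?_)
      exact Finset.card_le_card
        (Finset.monotone_filter_right _ fun i _ hi => le_trans hi (hβ hω.2 hjm))
  refine ⟨hbound, fun hp j hj1 hjm => (hbound j hj1 hjm).trans ?_⟩
  rw [integral_card_filter_le P hmeas (β j)]
  have hβnonneg : 0 ≤ β j := hβ0 ▸ hβ (Nat.zero_le j) hjm
  calc ∑ i, P.real {ω | phat i ω ≤ β j} ≤ ∑ _i : Fin t, β j :=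
        Finset.sum_le_sum fun i _ => measureReal_le_of_superuniform P (hp i) hβnonneg
    _ = t * β j := by simp
end

section
/- Let 0 = β_0 ≤ β_1 ≤ ⋯ ≤ β_m ≤ 1 with m ≤ t, and suppose t · Σ_{i=1}^m (β_i − β_{i−1})/i ≤ 1. Then there exist a probability space and random variables p̂_1, …, p̂_t, each marginally uniformly distributed on (0,1), whose ordered values p̂_(1) ≤ ⋯ ≤ p̂_(t) satisfy P{⋃_{i=1}^m {p̂_(i) ≤ β_i}} = t · Σ_{i=1}^m (β_i − β_{i−1})/i; that is, the Hommel-type bound is sharp. -/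
open MeasureTheory Set

/-- If more than `n` elements of a multiset are at most `b`, so is its `n`-th smallest element. -/
theorem orderStat_le_of_lt_countP {l : Multiset ℝ} {n : ℕ} {b : ℝ}
    (h : n < l.countP (· ≤ b)) : orderStat l n ≤ b := by
  have hlen : (l.sort (· ≤ ·)).length = l.card := Multiset.length_sort ..
  have hn : n < (l.sort (· ≤ ·)).length := by
    rw [hlen]; exact h.trans_le (Multiset.countP_le_card _ _)
  have hcount : l.countP (· ≤ b) = (l.sort (· ≤ ·)).countP (· ≤ b) := by
    conv_lhs => rw [← Multiset.sort_eq l (· ≤ ·)]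
    rw [Multiset.coe_countP]
  have hsort : (l.sort (· ≤ ·)).Pairwise (· ≤ ·) := Multiset.pairwise_sort ..
  unfold orderStat
  generalize l.sort (· ≤ ·) = s at *
  rw [List.getD_eq_getElem _ _ hn]
  by_contra! hb
  have hdrop : (s.drop n).countP (· ≤ b) = 0 := by
    rw [List.countP_eq_zero]
    intro x hx
    obtain ⟨k, hk, rfl⟩ := List.mem_iff_getElem.1 hx
    rw [List.getElem_drop]
    have hle : s[n] ≤ s[n + k]'(by rw [List.length_drop] at hk; omega) :=
      hsort.rel_get_of_le (a := ⟨n, hn⟩) (b := ⟨n + k, by rw [List.length_drop] at hk; omega⟩)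
        (by simp)
    simpa using hb.trans_le hle
  have htake : (s.take n).countP (· ≤ b) ≤ n :=
    List.countP_le_length.trans (List.length_take_le n s)
  rw [hcount, ← List.take_append_drop n s, List.countP_append, hdrop] at h
  omega

/-- A lower bound for all elements of a multiset bounds its order statistics. -/
theorem lt_orderStat {l : Multiset ℝ} {n : ℕ} {b : ℝ} (hn : n < l.card)
    (h : ∀ x ∈ l, b < x) : b < orderStat l n := by
  have hn' : n < (l.sort (· ≤ ·)).length := by rwa [Multiset.length_sort]
  unfold orderStat
  rw [List.getD_eq_getElem _ _ hn']
  exact h _ ((Multiset.mem_sort (· ≤ ·)).1 (List.getElem_mem hn'))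

/-- The distribution function of the uniform law on `[a, b]`, scaled by `b - a`. -/
theorem sub_mul_volume_real_affine_le {a b : ℝ} (hab : a ≤ b) (u : ℝ) :
    (b - a) * (volume : Measure unitInterval).real {x | a + (b - a) * (x : ℝ) ≤ u}
      = min u b - min u a := by
  rcases hab.eq_or_lt with rfl | hlt
  · simp
  have hpos : 0 < b - a := sub_pos.2 hlt
  have hset : {x : unitInterval | a + (b - a) * (x : ℝ) ≤ u}
      = Subtype.val ⁻¹' Set.Iic ((u - a) / (b - a)) := by
    ext x
    simp only [mem_ofPred_eq, mem_preimage, mem_Iic, le_div_iff₀ hpos]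
    constructor <;> intro h <;> linarith
  have hvol : (volume : Measure unitInterval) = Measure.comap Subtype.val volume := rfl
  have hinter : Subtype.val '' ((Subtype.val : unitInterval → ℝ) ⁻¹' Set.Iic ((u - a) / (b - a)))
      = Set.Icc 0 (min 1 ((u - a) / (b - a))) := by
    rw [Subtype.image_preimage_coe]
    ext x
    simp only [mem_inter_iff, mem_Icc, mem_Iic, le_min_iff]
    tauto
  rw [hset, Measure.real, hvol,
    (MeasurableEmbedding.subtype_coe measurableSet_Icc).comap_apply, hinter, Real.volume_Icc,
    ENNReal.toReal_ofReal', sub_zero, mul_max_of_nonneg _ _ hpos.le, mul_min_of_nonneg _ _ hpos.le,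
    mul_div_cancel₀ _ hpos.ne', mul_one, mul_zero]
  rcases le_total u a with h1 | h1 <;> rcases le_total u b with h2 | h2
  · rw [min_eq_left h1, min_eq_left h2, min_eq_right (by linarith), max_eq_right (by linarith)]
    ring
  · linarith
  · rw [min_eq_right h1, min_eq_left h2, min_eq_right (by linarith), max_eq_left (by linarith)]
  · rw [min_eq_right h1, min_eq_right h2, min_eq_left (by linarith), max_eq_left (by linarith)]

/-- The number of `j` for which `k` lies in the cyclic interval of length `i` starting at `j`. -/
theorem card_filter_sub_val_lt {t : ℕ} [NeZero t] (k : Fin t) {i : ℕ} (hi : i ≤ t) :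
    (Finset.univ.filter fun j : Fin t => (k - j).val < i).card = i := by
  rw [Finset.card_equiv (t := Finset.univ.filter fun l : Fin t => l.val < i) (Equiv.subLeft k)
    (by simp), Fin.card_filter_val_lt, min_eq_right hi]

/-- A cyclic interval of length `i` has `i` elements. -/
theorem card_filter_val_sub_lt {t : ℕ} [NeZero t] (j : Fin t) {i : ℕ} (hi : i ≤ t) :
    (Finset.univ.filter fun k : Fin t => (k - j).val < i).card = i := by
  rw [Finset.card_equiv (t := Finset.univ.filter fun l : Fin t => l.val < i) (Equiv.subRight j)
    (by simp), Fin.card_filter_val_lt, min_eq_right hi]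

/-- The mixture, with weights `c`, of the copies of the unit interval indexed by `ι`. -/
noncomputable def unitIntervalMixture {ι : Type} [Fintype ι] [MeasurableSpace ι] (c : ι → ℝ) :
    Measure (ι × unitInterval) :=
  ∑ i, ENNReal.ofReal (c i) • Measure.map (Prod.mk i) volume

theorem unitIntervalMixture_apply {ι : Type} [Fintype ι] [MeasurableSpace ι]
    [MeasurableSingletonClass ι] {c : ι → ℝ} (hc : ∀ i, 0 ≤ c i) (s : Set (ι × unitInterval)) :
    unitIntervalMixture c s
      = ENNReal.ofReal (∑ i, c i * (volume : Measure unitInterval).real {x | (i, x) ∈ s}) := by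
  rw [unitIntervalMixture, Measure.finsetSum_apply,
    ENNReal.ofReal_sum_of_nonneg fun i _ => mul_nonneg (hc i) measureReal_nonneg]
  refine Finset.sum_congr rfl fun i _ => ?_
  rw [Measure.smul_apply, smul_eq_mul, ENNReal.ofReal_mul (hc i),
    (measurableEmbedding_prodMk_left i).map_apply, ofReal_measureReal]
  rfl

/-- Lemma 3.1(ii) of Lehmann–Romano: the Hommel-type bound is sharp. If
`0 = β_0 ≤ β_1 ≤ ⋯ ≤ β_m ≤ 1` with `m ≤ t` and `t Σ_{i=1}^m (β_i − β_{i−1})/i ≤ 1`,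
then there are marginally `U(0,1)` random variables `p̂_1, …, p̂_t` with
`P(⋃_{i=1}^m {p̂_(i) ≤ β_i}) = t Σ_{i=1}^m (β_i − β_{i−1})/i`. -/
theorem hommel_type_bound_sharp
    (t : ℕ) (ht : 1 ≤ t) (m : ℕ) (hm1 : 1 ≤ m) (hmt : m ≤ t)
    (β : ℕ → ℝ) (hβ0 : β 0 = 0) (hβmono : ∀ i < m, β i ≤ β (i + 1)) (hβ1 : β m ≤ 1)
    (hsum : (t : ℝ) * ∑ i ∈ Finset.Icc 1 m, (β i - β (i - 1)) / (i : ℝ) ≤ 1) :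
    ∃ (Ω : Type) (inst : MeasurableSpace Ω) (P : Measure Ω)
      (instP : IsProbabilityMeasure P) (phat : Fin t → Ω → ℝ),
      (∀ i, Measurable (phat i)) ∧
      (∀ i ω, phat i ω ∈ Set.Icc (0:ℝ) 1) ∧
      (∀ i, ∀ u ∈ Set.Ioo (0:ℝ) 1, P {ω | phat i ω ≤ u} = ENNReal.ofReal u) ∧
      P {ω | ∃ i, 1 ≤ i ∧ i ≤ m ∧
          orderStat (Multiset.map (fun idx => phat idx ω) Finset.univ.val) (i - 1) ≤ β i}
        = ENNReal.ofReal ((t : ℝ) * ∑ i ∈ Finset.Icc 1 m, (β i - β (i - 1)) / (i : ℝ)) := by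
  have : NeZero t := ⟨by omega⟩
  have hmono : MonotoneOn β (Set.Iic m) :=
    monotoneOn_of_le_succ Set.ordConnected_Iic fun i _ _ hi => hβmono i hi
  have hle : ∀ i ≤ m, β i ≤ β m := fun i hi => hmono hi Set.self_mem_Iic hi
  have hpred : ∀ i ≤ m, β (i - 1) ≤ β i := fun i hi =>
    hmono (show i - 1 ≤ m by omega) hi (by omega)
  have hnn : ∀ i ≤ m, 0 ≤ β i := fun i hi => hβ0 ▸ hmono (Nat.zero_le m) hi (Nat.zero_le i)
  have ht0 : (0 : ℝ) < t := by exact_mod_cast ht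
  set S := ∑ i ∈ Finset.Icc 1 m, (β i - β (i - 1)) / (i : ℝ) with hS
  have hSrange : S = ∑ i ∈ Finset.range m, (β (i + 1) - β i) / ((i + 1 : ℕ) : ℝ) := by
    rw [hS, Finset.range_eq_Ico]
    exact (Finset.sum_Ico_add' (fun i => (β i - β (i - 1)) / (i : ℝ)) 0 m 1).symm
  let c : ℕ → ℝ := fun i => if i = 0 then (1 - t * S) / t else (β i - β (i - 1)) / i
  have hc : ∀ i ≤ m, 0 ≤ c i := by
    intro i hi
    by_cases h : i = 0
    · simp only [c, h, if_true]
      exact div_nonneg (by linarith) ht0.le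
    · simp only [c, h, if_false]
      exact div_nonneg (by linarith [hpred i hi]) (Nat.cast_nonneg i)
  have hci : ∀ i, c i * i = β i - β (i - 1) := by
    intro i
    rcases i with _ | i
    · simp
    · simp only [c, Nat.succ_ne_zero, if_false]
      exact div_mul_cancel₀ _ (by positivity)
  have hcsum : ∑ i ∈ Finset.range (m + 1), c i = 1 / t := by
    rw [Finset.sum_range_succ']
    have : ∑ i ∈ Finset.range m, c (i + 1) = S := hSrange.symm
    rw [this]
    simp only [c, if_true]
    field_simp
    ring
  have hcisum : ∑ i ∈ Finset.range (m + 1), c i * i = β m := by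
    simp only [hci]
    rw [Finset.sum_range_succ']
    simpa [hβ0] using Finset.sum_range_sub β m
  let w : Fin t × Fin (m + 1) → ℝ := fun q => c q.2
  have hw : ∀ q, 0 ≤ w q := fun q => hc _ (by omega)
  let f : Fin t → (Fin t × Fin (m + 1)) × unitInterval → ℝ := fun k ω =>
    if (k - ω.1.1).val < (ω.1.2 : ℕ)
    then β (ω.1.2 - 1) + (β ω.1.2 - β (ω.1.2 - 1)) * (ω.2 : ℝ)
    else β m + (1 - β m) * (ω.2 : ℝ)
  refine ⟨(Fin t × Fin (m + 1)) × unitInterval, inferInstance, unitIntervalMixture w, ⟨?_⟩, f,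
    ?_, ?_, ?_, ?_⟩
  · rw [unitIntervalMixture_apply hw]
    simp only [mem_univ, ofPred_true, probReal_univ, mul_one, w, Fintype.sum_prod_type,
      Finset.sum_const, Finset.card_univ, Fintype.card_fin, nsmul_eq_mul]
    rw [Fin.sum_univ_eq_sum_range c, hcsum, mul_one_div_cancel ht0.ne', ENNReal.ofReal_one]
  · intro k
    refine measurable_from_prod_countable_right fun q => ?_
    by_cases h : (k - q.1).val < (q.2 : ℕ)
    · simp only [f, h, if_true]
      fun_prop
    · simp only [f, h, if_false]
      fun_prop
  · rintro k ⟨⟨j, i⟩, x⟩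
    have hi : (i : ℕ) ≤ m := by omega
    have h1 := hnn _ hi
    have h2 := hnn (i - 1) (by omega)
    have h3 := hpred i hi
    have h4 := hle i hi
    have h5 := hnn m le_rfl
    have h0 : (0 : ℝ) ≤ x := x.2.1
    have h0' : (x : ℝ) ≤ 1 := x.2.2
    by_cases h : (k - j).val < (i : ℕ)
    · simp only [f, h, if_true, mem_Icc]
      constructor <;> nlinarith
    · simp only [f, h, if_false, mem_Icc]
      constructor <;> nlinarith
  · intro k u hu
    rw [unitIntervalMixture_apply hw]
    congr 1
    let B := (volume : Measure unitInterval).real {x | β m + (1 - β m) * (x : ℝ) ≤ u}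
    let A : ℕ → ℝ := fun i => (volume : Measure unitInterval).real
      {x | β (i - 1) + (β i - β (i - 1)) * (x : ℝ) ≤ u}
    have hcell : ∀ (j : Fin t) (i : Fin (m + 1)),
        (volume : Measure unitInterval).real {x | ((j, i), x) ∈ {ω | f k ω ≤ u}}
          = if (k - j).val < (i : ℕ) then A i else B := by
      intro j i
      by_cases h : (k - j).val < (i : ℕ) <;> simp [f, A, B, h]
    have hrow : ∀ i : Fin (m + 1),
        ∑ j : Fin t, w (j, i) * (if (k - j).val < (i : ℕ) then A i else B)
          = (β i - β (i - 1)) * A i + (t * c i - c i * (i : ℕ)) * B := by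
      intro i
      have hit : (i : ℕ) ≤ t := by omega
      have hcard := card_filter_sub_val_lt k hit
      have hcard' : ((Finset.univ.filter fun j : Fin t => ¬ (k - j).val < (i : ℕ)).card : ℝ)
          = t - (i : ℕ) := by
        have := Finset.card_filter_add_card_filter_not (s := (Finset.univ : Finset (Fin t)))
          (fun j => (k - j).val < (i : ℕ))
        rw [hcard, Finset.card_univ, Fintype.card_fin] at this
        rw [eq_sub_iff_add_eq']
        exact_mod_cast this
      simp only [w]
      rw [← Finset.mul_sum, Finset.sum_ite, Finset.sum_const, Finset.sum_const, nsmul_eq_mul,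
        nsmul_eq_mul, hcard, hcard', ← hci]
      ring
    simp only [Fintype.sum_prod_type, hcell]
    rw [Finset.sum_comm]
    simp only [hrow]
    rw [Fin.sum_univ_eq_sum_range
        (fun i => (β i - β (i - 1)) * A i + (t * c i - c i * (i : ℕ)) * B),
      Finset.sum_add_distrib, ← Finset.sum_mul, Finset.sum_sub_distrib, ← Finset.mul_sum, hcsum,
      hcisum, mul_one_div_cancel ht0.ne', sub_mul_volume_real_affine_le hβ1 u,
      Finset.sum_congr rfl fun i hi => sub_mul_volume_real_affine_le
        (hpred i (Nat.lt_succ_iff.1 (Finset.mem_range.1 hi))) u,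
      Finset.sum_range_succ']
    simp only [Nat.add_sub_cancel, zero_tsub, sub_self, add_zero]
    rw [Finset.sum_range_sub (fun i => min u (β i)), hβ0, min_eq_right hu.1.le,
      min_eq_left hu.2.le]
    ring
  · rw [unitIntervalMixture_apply hw]
    congr 1
    set E := {ω | ∃ i, 1 ≤ i ∧ i ≤ m ∧
      orderStat (Multiset.map (fun idx => f idx ω) Finset.univ.val) (i - 1) ≤ β i}
    have hpos : ∀ (j : Fin t) (i : Fin (m + 1)), (i : ℕ) ≠ 0 → ∀ x, ((j, i), x) ∈ E := by
      intro j i hi0 x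
      refine ⟨i, by omega, by omega, orderStat_le_of_lt_countP ?_⟩
      rw [Multiset.countP_map]
      have hcard := card_filter_val_sub_lt j (i := i) (by omega)
      have hsub : (Finset.univ.filter fun k : Fin t => (k - j).val < (i : ℕ))
          ⊆ Finset.univ.filter fun k : Fin t => f k ((j, i), x) ≤ β i := by
        intro k hk
        have hk' : (k - j).val < (i : ℕ) := (Finset.mem_filter.1 hk).2
        refine Finset.mem_filter.2 ⟨Finset.mem_univ k, ?_⟩
        simp only [f, hk', if_true]
        have h0 : (x : ℝ) ≤ 1 := x.2.2
        have h3 := hpred i (by omega)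
        nlinarith
      have := Finset.card_le_card hsub
      rw [hcard] at this
      change _ < (Finset.univ.filter fun k : Fin t => f k ((j, i), x) ≤ β i).card
      omega
    have hzero : ∀ j : Fin t, c 0 * (volume : Measure unitInterval).real
        {x | ((j, 0), x) ∈ E} = 0 := by
      intro j
      rcases hβ1.eq_or_lt with h1 | h1
      · have hbound : β m ≤ t * S := by
          rw [← hcisum, Finset.sum_range_succ', hSrange, Finset.mul_sum]
          simp only [Nat.cast_zero, mul_zero, add_zero]
          refine Finset.sum_le_sum fun i hi => ?_
          have him := Finset.mem_range.1 hi
          rw [mul_comm]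
          exact mul_le_mul_of_nonneg_right (by exact_mod_cast (by omega : i + 1 ≤ t))
            (hc (i + 1) him)
        have : c 0 = 0 := by
          simp only [c, if_true]
          rw [show (t : ℝ) * S = 1 by linarith, sub_self, zero_div]
        rw [this, zero_mul]
      · have hsub : {x | ((j, 0), x) ∈ E} ⊆ {(0 : unitInterval)} := by
          rintro x ⟨i, hi1, him, hstat⟩
          by_contra hx
          have hx0 : (0 : ℝ) < x := unitInterval.pos_iff_ne_zero.2 hx
          refine hstat.not_gt (lt_orderStat ?_ ?_)
          · rw [Multiset.card_map, Finset.card_val, Finset.card_univ, Fintype.card_fin]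
            omega
          · intro y hy
            obtain ⟨k, -, rfl⟩ := Multiset.mem_map.1 hy
            have := hle i him
            simp only [f, Fin.val_zero, Nat.not_lt_zero, if_false]
            nlinarith
        rw [Measure.real, measure_mono_null hsub (measure_singleton _), ENNReal.toReal_zero,
          mul_zero]
    have hone : ∀ (j : Fin t) (i : Fin m),
        (volume : Measure unitInterval).real {x | ((j, i.succ), x) ∈ E} = 1 := by
      intro j i
      rw [Set.eq_univ_of_forall (s := {x | ((j, i.succ), x) ∈ E})
        (hpos j i.succ (by simp)), probReal_univ]
    simp only [Fintype.sum_prod_type, Fin.sum_univ_succ, hone, w, Fin.val_zero, hzero, zero_add,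
      mul_one, Fin.val_succ, Finset.sum_const, Finset.card_univ, Fintype.card_fin, nsmul_eq_mul]
    rw [Fin.sum_univ_eq_sum_range (fun i => c (i + 1)), hSrange]
    rfl
end
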